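/- For every f ∈ F_α not almost everywhere equal to 0 and every real number λ ≥ q one has q^{−2b} ≤ τ_f(q^{j₀(λ,q)+1}) / T_f(λ) ≤ τ_f(q^{j₀(λ,q)−1}) / T_f(λ) ≤ q^{3b}. -/

import Mathlib

open MeasureTheory

/-- C(γ) = 2/π if γ = 1 and (1−γ)/(Γ(2−γ)cos(πγ/2)) otherwise. -/
noncomputable def Cfun (γ : ℝ) : ℝ :=
  if γ = 1 then 2 / Real.pi
  else (1 - γ) / (Real.Gamma (2 - γ) * Real.cos (Real.pi * γ / 2))

/-- T_f(λ) = ∫_ℝ |λ⁻¹ f(x)|^{α(x)} C(α(x)) dx. -/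
noncomputable def Tf (α f : ℝ → ℝ) (lam : ℝ) : ℝ :=
  ∫ x : ℝ, |lam⁻¹ * f x| ^ α x * Cfun (α x)

/-- τ_f(ξ) = ∫_ℝ φ(θ) (∫_ℝ |ξ⁻¹ θ f(x)|^{α(x)} dx) dθ. -/
noncomputable def tauF (α f φ : ℝ → ℝ) (ξ : ℝ) : ℝ :=
  ∫ θ : ℝ, φ θ * (∫ x : ℝ, |ξ⁻¹ * θ * f x| ^ α x)

/-- j₀(λ,q) = ⌊log λ / log q⌋. -/
noncomputable def j0 (lam q : ℝ) : ℤ :=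
  ⌊Real.log lam / Real.log q⌋

/-- The Laplace transform of `1 - cos`, with integrability. -/
lemma integrableOn_one_sub_cos_mul_exp {t : ℝ} (ht : 0 < t) :
    IntegrableOn (fun x : ℝ => (1 - Real.cos x) * Real.exp (-(x * t))) (Set.Ioi 0) ∧
    ∫ x in Set.Ioi (0 : ℝ), (1 - Real.cos x) * Real.exp (-(x * t)) = (t * (1 + t ^ 2))⁻¹ := by
  set g : ℝ → ℝ := fun x =>
    Real.exp (-(x * t)) * (-t⁻¹ - (Real.sin x - t * Real.cos x) / (1 + t ^ 2)) with hg
  have ht2 : (1 + t ^ 2 : ℝ) ≠ 0 := by positivity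
  have hder : ∀ x ∈ Set.Ici (0 : ℝ),
      HasDerivAt g ((1 - Real.cos x) * Real.exp (-(x * t))) x := by
    intro x _
    have h1 : HasDerivAt (fun x : ℝ => Real.exp (-(x * t))) (Real.exp (-(x * t)) * (-(1 * t))) x :=
      ((hasDerivAt_id x).mul_const t).neg.exp
    have h2 : HasDerivAt (fun x : ℝ => -t⁻¹ - (Real.sin x - t * Real.cos x) / (1 + t ^ 2))
        (-((Real.cos x - t * (-Real.sin x)) / (1 + t ^ 2))) x :=
      (((Real.hasDerivAt_sin x).sub ((Real.hasDerivAt_cos x).const_mul t)).div_const _).const_sub _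
    convert! h1.mul h2 using 1
    field_simp
    ring
  have hpos : ∀ x ∈ Set.Ioi (0 : ℝ), 0 ≤ (1 - Real.cos x) * Real.exp (-(x * t)) := fun x _ =>
    mul_nonneg (by linarith [Real.cos_le_one x]) (Real.exp_pos _).le
  have hlim : Filter.Tendsto g Filter.atTop (nhds 0) := by
    have he : Filter.Tendsto (fun x : ℝ => Real.exp (-(x * t))) Filter.atTop (nhds 0) :=
      Real.tendsto_exp_neg_atTop_nhds_zero.comp (Filter.tendsto_id.atTop_mul_const ht)
    refine bdd_le_mul_tendsto_zero' (t⁻¹ + (1 + t)) ?_ he |>.congr fun x => mul_comm _ _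
    refine Filter.Eventually.of_forall fun x => ?_
    have h3 : |Real.sin x - t * Real.cos x| ≤ 1 + t := by
      refine (abs_sub _ _).trans ?_
      rw [abs_mul, abs_of_pos ht]
      exact add_le_add (Real.abs_sin_le_one x)
        (mul_le_of_le_one_right ht.le (Real.abs_cos_le_one x))
    refine (abs_sub _ _).trans ?_
    rw [abs_neg, abs_of_pos (inv_pos.2 ht), abs_div, abs_of_pos (by positivity : 0 < 1 + t ^ 2)]
    gcongr
    exact (div_le_self (abs_nonneg _) (by nlinarith)).trans h3
  refine ⟨integrableOn_Ioi_deriv_of_nonneg' hder hpos hlim, ?_⟩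
  rw [integral_Ioi_of_hasDerivAt_of_nonneg' hder hpos hlim]
  simp only [hg, zero_mul, neg_zero, Real.exp_zero, Real.sin_zero, Real.cos_zero]
  field_simp
  ring

lemma lintegral_one_sub_cos_mul_exp {t : ℝ} (ht : 0 < t) :
    ∫⁻ x in Set.Ioi (0 : ℝ), ENNReal.ofReal ((1 - Real.cos x) * Real.exp (-(x * t))) =
      ENNReal.ofReal (t * (1 + t ^ 2))⁻¹ := by
  obtain ⟨h1, h2⟩ := integrableOn_one_sub_cos_mul_exp ht
  rw [← h2, ofReal_integral_eq_lintegral_ofReal h1]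
  exact Filter.Eventually.of_forall fun x =>
    mul_nonneg (by linarith [Real.cos_le_one x]) (Real.exp_pos _).le

lemma lintegral_rpow_mul_exp_neg_mul_rpow {p s c : ℝ} (hp : 0 < p) (hs : -1 < s) (hc : 0 < c) :
    ∫⁻ x in Set.Ioi (0 : ℝ), ENNReal.ofReal (x ^ s * Real.exp (-c * x ^ p)) =
      ENNReal.ofReal (c ^ (-(s + 1) / p) * (1 / p) * Real.Gamma ((s + 1) / p)) := by
  rw [← integral_rpow_mul_exp_neg_mul_rpow hp hs hc,
    ofReal_integral_eq_lintegral_ofReal (integrableOn_rpow_mul_exp_neg_mul_rpow hs hp hc)]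
  filter_upwards [ae_restrict_mem measurableSet_Ioi] with x hx
  have : 0 < x := hx
  positivity

lemma lintegral_rpow_div_one_add_sq {γ : ℝ} (h0 : 0 < γ) (h2 : γ < 2) :
    ∫⁻ t in Set.Ioi (0 : ℝ), ENNReal.ofReal (t ^ (γ - 1) / (1 + t ^ 2)) =
      ENNReal.ofReal (Real.pi / (2 * Real.sin (Real.pi * γ / 2))) := by
  have key : ∀ t ∈ Set.Ioi (0 : ℝ), ENNReal.ofReal (t ^ (γ - 1) / (1 + t ^ 2)) =
      ∫⁻ s in Set.Ioi (0 : ℝ),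
        ENNReal.ofReal (Real.exp (-s) * (t ^ (γ - 1) * Real.exp (-s * t ^ (2 : ℝ)))) := by
    intro t ht
    have ht : 0 < t := ht
    have h := lintegral_rpow_mul_exp_neg_mul_rpow (p := 1) (s := 0) (c := 1 + t ^ 2) one_pos
      (by norm_num) (by positivity)
    calc _ = ENNReal.ofReal (t ^ (γ - 1)) * ENNReal.ofReal ((1 + t ^ 2) ^ (-(0 + 1) / 1 : ℝ) *
          (1 / 1) * Real.Gamma ((0 + 1) / 1)) := by
          rw [← ENNReal.ofReal_mul (by positivity)]
          congr 1
          norm_num [Real.rpow_neg_one]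
          rfl
      _ = _ := by
          rw [← h, ← lintegral_const_mul' _ _ ENNReal.ofReal_ne_top]
          refine lintegral_congr fun s => ?_
          rw [← ENNReal.ofReal_mul (by positivity), Real.rpow_two, Real.rpow_zero, Real.rpow_one,
            one_mul, mul_left_comm, ← Real.exp_add]
          ring_nf
  rw [setLIntegral_congr_fun measurableSet_Ioi key, lintegral_lintegral_swap]
  · have key2 : ∀ s ∈ Set.Ioi (0 : ℝ), ∫⁻ t in Set.Ioi (0 : ℝ),
        ENNReal.ofReal (Real.exp (-s) * (t ^ (γ - 1) * Real.exp (-s * t ^ (2 : ℝ)))) =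
        ENNReal.ofReal (Real.Gamma (γ / 2) / 2) *
          ENNReal.ofReal (s ^ (-(γ / 2)) * Real.exp (-1 * s ^ (1 : ℝ))) := by
      intro s hs
      have hs : 0 < s := hs
      have hG : 0 < Real.Gamma (γ / 2) := Real.Gamma_pos_of_pos (by linarith)
      simp_rw [ENNReal.ofReal_mul (Real.exp_pos (-s)).le]
      rw [lintegral_const_mul' _ _ ENNReal.ofReal_ne_top,
        lintegral_rpow_mul_exp_neg_mul_rpow two_pos (by linarith) hs,
        ← ENNReal.ofReal_mul (by positivity), ← ENNReal.ofReal_mul (by positivity)]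
      congr 1
      rw [Real.rpow_one, sub_add_cancel, neg_div, neg_one_mul]
      ring
    rw [setLIntegral_congr_fun measurableSet_Ioi key2,
      lintegral_const_mul' _ _ ENNReal.ofReal_ne_top,
      lintegral_rpow_mul_exp_neg_mul_rpow one_pos (by linarith) one_pos,
      ← ENNReal.ofReal_mul (by
        have := Real.Gamma_pos_of_pos (by linarith : 0 < γ / 2); positivity)]
    congr 1
    have h := Real.Gamma_mul_Gamma_one_sub (γ / 2)
    rw [Real.one_rpow, div_one, div_one, one_mul, one_mul, neg_add_eq_sub, div_mul_eq_mul_div, h,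
      mul_div_assoc, div_div, mul_comm (Real.sin _)]
  · exact Measurable.aemeasurable (by unfold Function.uncurry; fun_prop)

lemma lintegral_one_sub_cos_mul_rpow {γ : ℝ} (h0 : 0 < γ) (h2 : γ < 2) :
    ∫⁻ x in Set.Ioi (0 : ℝ), ENNReal.ofReal ((1 - Real.cos x) * x ^ (-1 - γ)) =
      ENNReal.ofReal (Real.pi / (2 * Real.sin (Real.pi * γ / 2) * Real.Gamma (γ + 1))) := by
  have hG : 0 < Real.Gamma (γ + 1) := Real.Gamma_pos_of_pos (by linarith)
  have key : ∀ x ∈ Set.Ioi (0 : ℝ), ENNReal.ofReal ((1 - Real.cos x) * x ^ (-1 - γ)) =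
      ENNReal.ofReal (Real.Gamma (γ + 1))⁻¹ * ∫⁻ t in Set.Ioi (0 : ℝ),
        ENNReal.ofReal (t ^ γ * ((1 - Real.cos x) * Real.exp (-(x * t)))) := by
    intro x hx
    have hx : 0 < x := hx
    have hc : 0 ≤ 1 - Real.cos x := by linarith [Real.cos_le_one x]
    have h := lintegral_rpow_mul_exp_neg_mul_rpow (p := 1) (s := γ) one_pos (by linarith) hx
    have h' : ∫⁻ t in Set.Ioi (0 : ℝ),
        ENNReal.ofReal (t ^ γ * ((1 - Real.cos x) * Real.exp (-(x * t)))) =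
        ENNReal.ofReal (1 - Real.cos x) * ENNReal.ofReal (x ^ (-(γ + 1) / 1) * (1 / 1) *
          Real.Gamma ((γ + 1) / 1)) := by
      rw [← h, ← lintegral_const_mul' _ _ ENNReal.ofReal_ne_top]
      refine lintegral_congr fun t => ?_
      rw [← ENNReal.ofReal_mul hc, Real.rpow_one, neg_mul, mul_left_comm]
    rw [h', ← ENNReal.ofReal_mul hc, ← ENNReal.ofReal_mul (by positivity)]
    congr 1
    rw [div_one, div_one, show -(γ + 1) = -1 - γ by ring]
    field_simp
  rw [setLIntegral_congr_fun measurableSet_Ioi key, lintegral_const_mul' _ _ ENNReal.ofReal_ne_top,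
    lintegral_lintegral_swap]
  · have key2 : ∀ t ∈ Set.Ioi (0 : ℝ), ∫⁻ x in Set.Ioi (0 : ℝ),
        ENNReal.ofReal (t ^ γ * ((1 - Real.cos x) * Real.exp (-(x * t)))) =
        ENNReal.ofReal (t ^ (γ - 1) / (1 + t ^ 2)) := by
      intro t ht
      have ht : 0 < t := ht
      simp_rw [ENNReal.ofReal_mul (Real.rpow_nonneg ht.le γ)]
      rw [lintegral_const_mul' _ _ ENNReal.ofReal_ne_top, lintegral_one_sub_cos_mul_exp ht,
        ← ENNReal.ofReal_mul (by positivity)]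
      congr 1
      rw [Real.rpow_sub_one ht.ne']
      field_simp
    rw [setLIntegral_congr_fun measurableSet_Ioi key2, lintegral_rpow_div_one_add_sq h0 h2,
      ← ENNReal.ofReal_mul (by positivity)]
    congr 1
    field_simp
  · exact Measurable.aemeasurable (by unfold Function.uncurry; fun_prop)

lemma sin_half_pi_mul_pos {γ : ℝ} (h0 : 0 < γ) (h2 : γ < 2) : 0 < Real.sin (Real.pi * γ / 2) :=
  Real.sin_pos_of_pos_of_lt_pi (by positivity) (by nlinarith [Real.pi_pos])

/-- Uniform expression for `Cfun` obtained from the reflection formula. -/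
lemma Cfun_eq {γ : ℝ} (h0 : 0 < γ) (h2 : γ < 2) :
    Cfun γ = 2 * Real.Gamma γ * Real.sin (Real.pi * γ / 2) / Real.pi := by
  unfold Cfun
  split_ifs with h
  · simp [h]
  · have hne : 1 - γ ≠ 0 := sub_ne_zero.2 (Ne.symm h)
    have hG2 : Real.Gamma (2 - γ) = (1 - γ) * Real.Gamma (1 - γ) := by
      rw [← Real.Gamma_add_one hne]; ring_nf
    have hs2 : Real.sin (Real.pi * γ) =
        2 * Real.sin (Real.pi * γ / 2) * Real.cos (Real.pi * γ / 2) := by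
      rw [← Real.sin_two_mul]; ring_nf
    have hsp := sin_half_pi_mul_pos h0 h2
    have hGp : Real.Gamma (2 - γ) ≠ 0 := (Real.Gamma_pos_of_pos (by linarith)).ne'
    have hG1 : Real.Gamma (1 - γ) ≠ 0 := fun h' => hGp (by rw [hG2, h', mul_zero])
    have hs : Real.sin (Real.pi * γ) ≠ 0 := by
      rw [← Real.sin_pi_sub]
      intro h'
      have hpi := Real.pi_pos
      rcases lt_or_gt_of_ne h with h1 | h1
      · exact (Real.sin_pos_of_pos_of_lt_pi (x := Real.pi - Real.pi * γ) (by nlinarith)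
          (by nlinarith)).ne' h'
      · exact (Real.sin_neg_of_neg_of_neg_pi_lt (x := Real.pi - Real.pi * γ) (by nlinarith)
          (by nlinarith)).ne h'
    have hc : Real.cos (Real.pi * γ / 2) ≠ 0 := fun h' => hs (by rw [hs2, h', mul_zero])
    have href := Real.Gamma_mul_Gamma_one_sub γ
    rw [eq_div_iff hs, hs2] at href
    rw [hG2, div_eq_div_iff (mul_ne_zero (mul_ne_zero hne hG1) hc) Real.pi_ne_zero]
    linear_combination -(1 - γ) * href

lemma Cfun_pos {γ : ℝ} (h0 : 0 < γ) (h2 : γ < 2) : 0 < Cfun γ := by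
  have := sin_half_pi_mul_pos h0 h2
  have := Real.Gamma_pos_of_pos h0
  rw [Cfun_eq h0 h2]
  positivity

lemma integral_one_sub_cos_mul_rpow {γ : ℝ} (h0 : 0 < γ) (h2 : γ < 2) :
    IntegrableOn (fun x : ℝ => (1 - Real.cos x) * x ^ (-1 - γ)) (Set.Ioi 0) ∧
    ∫ x in Set.Ioi (0 : ℝ), (1 - Real.cos x) * x ^ (-1 - γ) = (γ * Cfun γ)⁻¹ := by
  have hnn : 0 ≤ᵐ[volume.restrict (Set.Ioi (0 : ℝ))]
      fun x : ℝ => (1 - Real.cos x) * x ^ (-1 - γ) := by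
    filter_upwards [ae_restrict_mem measurableSet_Ioi] with x hx
    exact mul_nonneg (by linarith [Real.cos_le_one x]) (Real.rpow_nonneg (le_of_lt hx) _)
  have hm : AEStronglyMeasurable (fun x : ℝ => (1 - Real.cos x) * x ^ (-1 - γ))
      (volume.restrict (Set.Ioi (0 : ℝ))) := by
    exact Measurable.aestronglyMeasurable (by fun_prop)
  have h := lintegral_one_sub_cos_mul_rpow h0 h2
  have hs := sin_half_pi_mul_pos h0 h2
  have hG := Real.Gamma_pos_of_pos h0
  constructor
  · refine (lintegral_ofReal_ne_top_iff_integrable hm hnn).1 ?_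
    rw [h]; exact ENNReal.ofReal_ne_top
  · rw [integral_eq_lintegral_of_nonneg_ae hnn hm, h, Real.Gamma_add_one h0.ne',
      ENNReal.toReal_ofReal (by positivity), Cfun_eq h0 h2]
    field_simp

lemma integral_one_sub_cos_mul_left_mul_rpow {γ : ℝ} (h0 : 0 < γ) (h2 : γ < 2) (θ : ℝ) :
    IntegrableOn (fun x : ℝ => (1 - Real.cos (θ * x)) * x ^ (-1 - γ)) (Set.Ioi 0) ∧
    ∫ x in Set.Ioi (0 : ℝ), (1 - Real.cos (θ * x)) * x ^ (-1 - γ) =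
      |θ| ^ γ * (γ * Cfun γ)⁻¹ := by
  rcases eq_or_ne θ 0 with rfl | hθ
  · simp [Real.zero_rpow h0.ne']
  have hp : 0 < |θ| := abs_pos.2 hθ
  obtain ⟨hi, hI⟩ := integral_one_sub_cos_mul_rpow h0 h2
  set k : ℝ → ℝ := fun x => (1 - Real.cos x) * x ^ (-1 - γ) with hk
  have heq : Set.EqOn (fun x : ℝ => |θ| ^ (1 + γ) * k (|θ| * x))
      (fun x : ℝ => (1 - Real.cos (θ * x)) * x ^ (-1 - γ)) (Set.Ioi 0) := by
    intro x hx
    have hx : 0 < x := hx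
    have hcos : Real.cos (|θ| * x) = Real.cos (θ * x) := by
      rw [← Real.cos_abs (θ * x), abs_mul, abs_of_pos hx]
    have hpow : |θ| ^ (1 + γ) * |θ| ^ (-1 - γ) = 1 := by
      rw [← Real.rpow_add hp]; simp
    simp only [hk, hcos]
    rw [Real.mul_rpow hp.le hx.le]
    linear_combination (1 - Real.cos (θ * x)) * x ^ (-1 - γ) * hpow
  constructor
  · refine IntegrableOn.congr_fun ?_ heq measurableSet_Ioi
    refine Integrable.const_mul ?_ _
    exact (integrableOn_Ioi_comp_mul_left_iff k 0 hp).2 (by rwa [mul_zero])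
  · rw [← setIntegral_congr_fun measurableSet_Ioi heq, integral_const_mul,
      integral_comp_mul_left_Ioi k 0 hp, mul_zero, hI, smul_eq_mul, Real.rpow_add hp, Real.rpow_one]
    field_simp

/-- The absolute moments of `φ` expressed through its cosine transform. -/
lemma moment_mul_eq_integral {γ : ℝ} (h0 : 0 < γ) (h2 : γ < 2) {φ g : ℝ → ℝ}
    (hφ : Integrable φ) (hmom : Integrable fun θ : ℝ => φ θ * |θ| ^ γ)
    (hg : ∀ x, ∫ θ : ℝ, φ θ * (1 - Real.cos (θ * x)) = g x) :
    IntegrableOn (fun x : ℝ => g x * x ^ (-1 - γ)) (Set.Ioi 0) ∧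
    (∫ θ : ℝ, φ θ * |θ| ^ γ) * (γ * Cfun γ)⁻¹ =
      ∫ x in Set.Ioi (0 : ℝ), g x * x ^ (-1 - γ) := by
  set F : ℝ → ℝ → ℝ := fun θ x => φ θ * ((1 - Real.cos (θ * x)) * x ^ (-1 - γ)) with hF
  have hFint : Integrable (Function.uncurry F) (volume.prod (volume.restrict (Set.Ioi 0))) := by
    refine (integrable_prod_iff ?_).2 ⟨?_, ?_⟩
    · refine AEStronglyMeasurable.mul (hφ.aestronglyMeasurable.comp_fst) ?_
      exact Measurable.aestronglyMeasurable (by fun_prop)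
    · exact Filter.Eventually.of_forall fun θ =>
        (integral_one_sub_cos_mul_left_mul_rpow h0 h2 θ).1.const_mul (φ θ)
    · refine (hmom.norm.mul_const (γ * Cfun γ)⁻¹).congr (Filter.Eventually.of_forall fun θ => ?_)
      have : ∀ x ∈ Set.Ioi (0 : ℝ), ‖Function.uncurry F (θ, x)‖ =
          |φ θ| * ((1 - Real.cos (θ * x)) * x ^ (-1 - γ)) := by
        intro x hx
        have h1 : 0 ≤ (1 - Real.cos (θ * x)) * x ^ (-1 - γ) :=
          mul_nonneg (by linarith [Real.cos_le_one (θ * x)]) (Real.rpow_nonneg (le_of_lt hx) _)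
        simp only [Function.uncurry, hF]
        rw [Real.norm_eq_abs, abs_mul, abs_of_nonneg h1]
      simp only
      rw [setIntegral_congr_fun measurableSet_Ioi this, integral_const_mul,
        (integral_one_sub_cos_mul_left_mul_rpow h0 h2 θ).2, Real.norm_eq_abs, abs_mul,
        abs_of_nonneg (Real.rpow_nonneg (abs_nonneg θ) γ), mul_assoc]
  have hinner : ∀ x, ∫ θ, F θ x = g x * x ^ (-1 - γ) := by
    intro x
    rw [← hg x, ← integral_mul_const]
    simp only [hF, mul_assoc]
  refine ⟨hFint.integral_prod_right.congr (Filter.Eventually.of_forall hinner), ?_⟩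
  have hswap := integral_integral_swap hFint
  simp_rw [hinner] at hswap
  rw [← hswap, ← integral_mul_const]
  refine integral_congr_ae (Filter.Eventually.of_forall fun θ => ?_)
  simp only [hF]
  rw [integral_const_mul, (integral_one_sub_cos_mul_left_mul_rpow h0 h2 θ).2, mul_assoc]

/-- If `1 - g` is a cut-off between `1` and `q`, the moments of `φ` are comparable to `Cfun`. -/
lemma moment_bounds {γ q : ℝ} (h0 : 0 < γ) (h2 : γ < 2) (hq : 1 < q) {φ g : ℝ → ℝ}
    (hφ : Integrable φ) (hmom : Integrable fun θ : ℝ => φ θ * |θ| ^ γ)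
    (hg : ∀ x, ∫ θ : ℝ, φ θ * (1 - Real.cos (θ * x)) = g x)
    (hg01 : ∀ x, g x ∈ Set.Icc (0 : ℝ) 1) (hg0 : ∀ x, |x| ≤ 1 → g x = 0)
    (hg1 : ∀ x, q ≤ |x| → g x = 1) :
    q ^ (-γ) * Cfun γ ≤ ∫ θ : ℝ, φ θ * |θ| ^ γ ∧ ∫ θ : ℝ, φ θ * |θ| ^ γ ≤ Cfun γ := by
  obtain ⟨hi, hI⟩ := moment_mul_eq_integral h0 h2 hφ hmom hg
  have hC := Cfun_pos h0 h2
  have hq0 : 0 < q := by linarith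
  have htail : ∀ c : ℝ, 0 < c → ∫ x in Set.Ioi c, x ^ (-1 - γ) = c ^ (-γ) * γ⁻¹ := by
    intro c hc
    rw [integral_Ioi_rpow_of_lt (by linarith) hc, show -1 - γ + 1 = -γ by ring, neg_div_neg_eq,
      div_eq_mul_inv]
  have h_int : ∀ c : ℝ, 0 < c → IntegrableOn (fun x : ℝ => x ^ (-1 - γ)) (Set.Ioi c) :=
    fun c hc => integrableOn_Ioi_rpow_of_lt (by linarith) hc
  have hup : ∫ x in Set.Ioi (0 : ℝ), g x * x ^ (-1 - γ) ≤ γ⁻¹ := by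
    have : ∫ x in Set.Ioi (0 : ℝ), g x * x ^ (-1 - γ) =
        ∫ x in Set.Ioi (1 : ℝ), g x * x ^ (-1 - γ) := by
      refine setIntegral_eq_of_subset_of_forall_sdiff_eq_zero measurableSet_Ioi
        (Set.Ioi_subset_Ioi zero_le_one) fun x hx => ?_
      have hx0 : 0 < x := hx.1
      have hx1 : x ≤ 1 := not_lt.1 hx.2
      rw [hg0 x (by rwa [abs_of_pos hx0]), zero_mul]
    rw [this]
    calc _ ≤ ∫ x in Set.Ioi (1 : ℝ), x ^ (-1 - γ) := by
          refine setIntegral_mono_on (hi.mono_set (Set.Ioi_subset_Ioi zero_le_one))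
            (h_int 1 one_pos) measurableSet_Ioi fun x hx => ?_
          exact mul_le_of_le_one_left
            (Real.rpow_nonneg (zero_le_one.trans (le_of_lt hx)) _) (hg01 x).2
      _ = γ⁻¹ := by rw [htail 1 one_pos, Real.one_rpow, one_mul]
  have hlow : q ^ (-γ) * γ⁻¹ ≤ ∫ x in Set.Ioi (0 : ℝ), g x * x ^ (-1 - γ) := by
    rw [← htail q hq0]
    calc _ = ∫ x in Set.Ioi q, g x * x ^ (-1 - γ) := by
          refine setIntegral_congr_fun measurableSet_Ioi fun x hx => ?_
          have hx : q < x := hx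
          rw [hg1 x (hx.le.trans (le_abs_self x)), one_mul]
      _ ≤ _ := by
          refine setIntegral_mono_set hi ?_ (Set.Ioi_subset_Ioi hq0.le).eventuallyLE
          filter_upwards [ae_restrict_mem measurableSet_Ioi] with x hx
          exact mul_nonneg (hg01 x).1 (Real.rpow_nonneg (le_of_lt hx) _)
  rw [← hI] at hup hlow
  rw [mul_inv, ← mul_assoc, mul_right_comm] at hup hlow
  have hγ : 0 < γ⁻¹ := inv_pos.2 h0
  constructor
  · have := le_of_mul_le_mul_right hlow hγ
    rwa [← div_eq_mul_inv, le_div_iff₀ hC] at this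
  · have := le_of_mul_le_mul_right (hup.trans_eq (one_mul _).symm) hγ
    rwa [← div_eq_mul_inv, div_le_iff₀ hC, one_mul] at this

lemma integral_mul_one_sub_cos {φ φhat : ℝ → ℝ} (hφint : Integrable φ)
    (hφhat : ∀ x : ℝ, (φhat x : ℂ) = ∫ θ : ℝ, Complex.exp (-(Complex.I * x * θ)) * (φ θ : ℂ))
    (x : ℝ) : ∫ θ : ℝ, φ θ * (1 - Real.cos (θ * x)) = φhat 0 - φhat x := by
  have hcosint : ∀ x : ℝ, Integrable fun θ : ℝ => φ θ * Real.cos (θ * x) := fun x =>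
    hφint.mul_bdd (c := 1) (Measurable.aestronglyMeasurable (by fun_prop))
      (Filter.Eventually.of_forall fun θ => Real.abs_cos_le_one _)
  have hcos : ∀ x : ℝ, φhat x = ∫ θ : ℝ, φ θ * Real.cos (θ * x) := by
    intro x
    have hexp : ∀ θ : ℝ, Complex.exp (-(Complex.I * x * θ)) =
        Complex.exp ((-(x * θ) : ℝ) * Complex.I) := fun θ => by
      congr 1; push_cast; ring
    have h_int : Integrable fun θ : ℝ => Complex.exp (-(Complex.I * x * θ)) * (φ θ : ℂ) := by
      refine hφint.ofReal.bdd_mul (c := 1) (Continuous.aestronglyMeasurable (by fun_prop)) ?_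
      refine Filter.Eventually.of_forall fun θ => ?_
      rw [hexp, Complex.norm_exp_ofReal_mul_I]
    have h := congrArg Complex.re (hφhat x)
    rw [Complex.ofReal_re] at h
    rw [h, ← RCLike.re_eq_complex_re, ← integral_re h_int]
    refine integral_congr_ae (Filter.Eventually.of_forall fun θ => ?_)
    simp only
    rw [RCLike.re_eq_complex_re, hexp, Complex.re_mul_ofReal, Complex.exp_ofReal_mul_I_re,
      Real.cos_neg, mul_comm, mul_comm x]
  rw [hcos 0, hcos x, ← integral_sub (hcosint 0) (hcosint x)]
  simp only [mul_sub, mul_zero, Real.cos_zero]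

lemma rpow_le_rpow_mul_rpow {u v c b s : ℝ} (hu : 0 ≤ u) (hv : 0 ≤ v) (hc : 1 ≤ c)
    (huv : u ≤ c * v) (hs : 0 ≤ s) (hsb : s ≤ b) : u ^ s ≤ c ^ b * v ^ s :=
  calc u ^ s ≤ (c * v) ^ s := Real.rpow_le_rpow hu huv hs
    _ = c ^ s * v ^ s := Real.mul_rpow (by linarith) hv
    _ ≤ c ^ b * v ^ s :=
      mul_le_mul_of_nonneg_right (Real.rpow_le_rpow_of_exponent_le hc hsb) (Real.rpow_nonneg hv s)

lemma integrable_abs_const_mul_rpow {a b : ℝ} (ha : 0 < a) {α f : ℝ → ℝ} (hαm : Measurable α)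
    (hα : ∀ x, α x ∈ Set.Icc a b) (hfm : Measurable f)
    (hfi : Integrable fun x => |f x| ^ α x) (c : ℝ) :
    Integrable fun x => |c * f x| ^ α x := by
  refine (hfi.const_mul ((1 + |c|) ^ b)).mono' (Measurable.aestronglyMeasurable (by fun_prop))
    (Filter.Eventually.of_forall fun x => ?_)
  rw [Real.norm_eq_abs, abs_of_nonneg (by positivity), abs_mul]
  exact rpow_le_rpow_mul_rpow (by positivity) (abs_nonneg _) (by linarith [abs_nonneg c])
    (mul_le_mul_of_nonneg_right (by linarith) (abs_nonneg _)) (ha.le.trans (hα x).1) (hα x).2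

/-- Fubini for `tauF`: it is the integral of `|ξ⁻¹ f|^α` weighted by the moments of `φ`. -/
lemma tauF_eq {a b : ℝ} (ha : 0 < a) {α f φ : ℝ → ℝ} (hαm : Measurable α)
    (hα : ∀ x, α x ∈ Set.Icc a b) (hφ : AEStronglyMeasurable φ)
    (hmom : Integrable fun θ : ℝ => (1 + |θ|) ^ b * |φ θ|) (hfm : Measurable f)
    (hfi : Integrable fun x => |f x| ^ α x) (ξ : ℝ) :
    Integrable (fun x => |ξ⁻¹ * f x| ^ α x * ∫ θ : ℝ, φ θ * |θ| ^ α x) ∧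
    tauF α f φ ξ = ∫ x, |ξ⁻¹ * f x| ^ α x * ∫ θ : ℝ, φ θ * |θ| ^ α x := by
  have hfξ := integrable_abs_const_mul_rpow ha hαm hα hfm hfi ξ⁻¹
  set F : ℝ → ℝ → ℝ := fun θ x => φ θ * |ξ⁻¹ * θ * f x| ^ α x with hF
  have hsplit : ∀ θ x, F θ x = |ξ⁻¹ * f x| ^ α x * (φ θ * |θ| ^ α x) := by
    intro θ x
    simp only [hF]
    rw [show ξ⁻¹ * θ * f x = (ξ⁻¹ * f x) * θ by ring, abs_mul _ θ,
      Real.mul_rpow (abs_nonneg _) (abs_nonneg _)]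
    ring
  have hFint : Integrable (Function.uncurry F) (volume.prod volume) := by
    refine (hmom.mul_prod hfξ).mono' ?_ (Filter.Eventually.of_forall fun z => ?_)
    · exact hφ.comp_fst.mul (Measurable.aestronglyMeasurable (by fun_prop))
    · obtain ⟨θ, x⟩ := z
      simp only [Function.uncurry]
      have h1 : |θ| ^ α x ≤ (1 + |θ|) ^ b := by
        have := rpow_le_rpow_mul_rpow (u := |θ|) (v := 1) (c := 1 + |θ|) (abs_nonneg _)
          zero_le_one (by linarith [abs_nonneg θ]) (by linarith) (ha.le.trans (hα x).1) (hα x).2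
        rwa [Real.one_rpow, mul_one] at this
      rw [hsplit, Real.norm_eq_abs, abs_mul, abs_mul (φ θ), abs_of_nonneg (by positivity),
        abs_of_nonneg (by positivity : 0 ≤ |θ| ^ α x), mul_comm, mul_comm |φ θ|]
      gcongr
  have hinner : ∀ x, ∫ θ, F θ x = |ξ⁻¹ * f x| ^ α x * ∫ θ : ℝ, φ θ * |θ| ^ α x := by
    intro x
    simp_rw [hsplit]
    exact integral_const_mul _ _
  refine ⟨hFint.integral_prod_right.congr (Filter.Eventually.of_forall hinner), ?_⟩
  have hswap := integral_integral_swap hFint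
  simp_rw [hinner] at hswap
  rw [← hswap]
  simp only [tauF, hF, integral_const_mul]

lemma measurable_Cfun_comp {a b : ℝ} (ha : 0 < a) (hb : b < 2) {α : ℝ → ℝ} (hαm : Measurable α)
    (hα : ∀ x, α x ∈ Set.Icc a b) : Measurable fun x => Cfun (α x) := by
  have hα0 : ∀ x, α x ∈ Set.Ioi (0 : ℝ) := fun x => ha.trans_le (hα x).1
  have hcont : ContinuousOn Real.Gamma (Set.Ioi 0) := fun s hs =>
    (Real.differentiableAt_Gamma fun m =>
      ((neg_nonpos.2 m.cast_nonneg).trans_lt hs).ne').continuousAt.continuousWithinAt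
  have hG : Measurable fun x => Real.Gamma (α x) :=
    hcont.domRestrict.measurable.comp (hαm.subtype_mk (h := hα0))
  have : (fun x => Cfun (α x)) =
      fun x => 2 * Real.Gamma (α x) * Real.sin (Real.pi * α x / 2) / Real.pi :=
    funext fun x => Cfun_eq (hα0 x) ((hα x).2.trans_lt hb)
  rw [this]
  fun_prop

lemma zpow_j0_le {q lam : ℝ} (hq : 1 < q) (hlam : 0 < lam) : q ^ j0 lam q ≤ lam := by
  have hq0 : 0 < q := by linarith
  rw [← Real.rpow_intCast, ← Real.le_logb_iff_rpow_le hq hlam]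
  exact Int.floor_le _

lemma lt_zpow_j0_add_one {q lam : ℝ} (hq : 1 < q) (hlam : 0 < lam) : lam < q ^ (j0 lam q + 1) := by
  rw [← Real.rpow_intCast, ← Real.logb_lt_iff_lt_rpow hq hlam]
  push_cast
  exact Int.lt_floor_add_one _

/-- Decreasing the scale increases `|ξ⁻¹ y|^s`, by at most a power of the ratio of the scales. -/
lemma abs_inv_mul_rpow_le {ξ η c b s : ℝ} (hξ : 0 < ξ) (hη : 0 < η) (hc : 1 ≤ c) (h : η ≤ c * ξ)
    (hs : 0 ≤ s) (hsb : s ≤ b) (y : ℝ) : |ξ⁻¹ * y| ^ s ≤ c ^ b * |η⁻¹ * y| ^ s := by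
  refine rpow_le_rpow_mul_rpow (abs_nonneg _) (abs_nonneg _) hc ?_ hs hsb
  rw [abs_mul, abs_mul, abs_of_pos (inv_pos.2 hξ), abs_of_pos (inv_pos.2 hη), ← mul_assoc]
  refine mul_le_mul_of_nonneg_right ?_ (abs_nonneg y)
  rw [← div_eq_mul_inv, le_div_iff₀ hη, inv_mul_le_iff₀ hξ, mul_comm]
  exact h

/-- for every f ∈ F_α not a.e. 0 and every λ ≥ q,
q^{−2b} ≤ τ_f(q^{j₀(λ,q)+1})/T_f(λ) ≤ τ_f(q^{j₀(λ,q)−1})/T_f(λ) ≤ q^{3b}. -/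
theorem tau_ratio_bounds
    (a b : ℝ) (ha : 0 < a) (hab : a < b) (hb : b < 2)
    (α : ℝ → ℝ) (hαm : Measurable α) (hα : ∀ x, α x ∈ Set.Icc a b)
    (q : ℝ) (hq1 : 1 < q)
    (φ : ℝ → ℝ) (hφeven : ∀ θ, φ (-θ) = φ θ) (hφint : Integrable φ)
    (hφmom : ∀ γ ∈ Set.Ico (0 : ℝ) 4, Integrable (fun θ : ℝ => (1 + |θ|) ^ γ * |φ θ|))
    (φhat : ℝ → ℝ)
    (hφhat : ∀ x : ℝ, (φhat x : ℂ) = ∫ θ : ℝ, Complex.exp (-(Complex.I * x * θ)) * (φ θ : ℂ))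
    (hφhat01 : ∀ x, φhat x ∈ Set.Icc (0 : ℝ) 1)
    (hφhat1 : ∀ x : ℝ, |x| ≤ 1 → φhat x = 1)
    (hφhat0 : ∀ x : ℝ, (1 + q) / 2 ≤ |x| → φhat x = 0)
    (f : ℝ → ℝ) (hfm : Measurable f) (hfi : Integrable (fun x => |f x| ^ α x))
    (hf0 : ¬ (f =ᵐ[volume] 0))
    (lam : ℝ) (hlam : q ≤ lam) :
    q ^ (-(2 * b)) ≤ tauF α f φ (q ^ (j0 lam q + 1)) / Tf α f lam ∧
    tauF α f φ (q ^ (j0 lam q + 1)) / Tf α f lam ≤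
      tauF α f φ (q ^ (j0 lam q - 1)) / Tf α f lam ∧
    tauF α f φ (q ^ (j0 lam q - 1)) / Tf α f lam ≤ q ^ (3 * b) := by
  have hq0 : 0 < q := by linarith
  have hlam0 : 0 < lam := by linarith
  have hα0 : ∀ x, 0 < α x := fun x => ha.trans_le (hα x).1
  have hα2 : ∀ x, α x < 2 := fun x => (hα x).2.trans_lt hb
  set m : ℝ → ℝ := fun x => ∫ θ : ℝ, φ θ * |θ| ^ α x with hm
  have hmbd : ∀ x, q ^ (-α x) * Cfun (α x) ≤ m x ∧ m x ≤ Cfun (α x) := by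
    intro x
    refine moment_bounds (hα0 x) (hα2 x) hq1 (g := fun y => 1 - φhat y) hφint ?_ ?_ ?_ ?_ ?_
    · refine (hφmom (α x) ⟨(hα0 x).le, by linarith [hα2 x]⟩).mono'
        (hφint.aestronglyMeasurable.mul (Measurable.aestronglyMeasurable (by fun_prop)))
        (Filter.Eventually.of_forall fun θ => ?_)
      rw [Real.norm_eq_abs, abs_mul, abs_of_nonneg (by positivity : 0 ≤ |θ| ^ α x), mul_comm]
      exact mul_le_mul_of_nonneg_right
        (Real.rpow_le_rpow (abs_nonneg θ) (by linarith) (hα0 x).le) (abs_nonneg _)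
    · intro y
      rw [integral_mul_one_sub_cos hφint hφhat y, hφhat1 0 (by simp)]
    · exact fun y => ⟨by linarith [(hφhat01 y).2], by linarith [(hφhat01 y).1]⟩
    · intro y hy
      simp only [hφhat1 y hy, sub_self]
    · intro y hy
      simp only [hφhat0 y (by linarith), sub_zero]
  have hCpos : ∀ x, 0 < Cfun (α x) := fun x => Cfun_pos (hα0 x) (hα2 x)
  have hmpos : ∀ x, 0 ≤ m x := fun x =>
    (mul_nonneg (Real.rpow_nonneg hq0.le _) (hCpos x).le).trans (hmbd x).1
  have hCm : ∀ x, Cfun (α x) ≤ q ^ b * m x := by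
    intro x
    have h1 : Cfun (α x) ≤ q ^ α x * m x := by
      have h2 := (hmbd x).1
      rwa [Real.rpow_neg hq0.le, inv_mul_le_iff₀ (Real.rpow_pos_of_pos hq0 _)] at h2
    exact h1.trans (mul_le_mul_of_nonneg_right
      (Real.rpow_le_rpow_of_exponent_le hq1.le (hα x).2) (hmpos x))
  have htau := tauF_eq ha hαm hα hφint.aestronglyMeasurable
    (hφmom b ⟨by linarith, by linarith⟩) hfm hfi
  have hnn : ∀ ξ x, 0 ≤ |ξ⁻¹ * f x| ^ α x := fun ξ x => Real.rpow_nonneg (abs_nonneg _) _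
  have hTint : Integrable fun x => |lam⁻¹ * f x| ^ α x * Cfun (α x) := by
    refine ((htau lam).1.const_mul (q ^ b)).mono' ?_ (Filter.Eventually.of_forall fun x => ?_)
    · have := measurable_Cfun_comp ha hb hαm hα
      exact Measurable.aestronglyMeasurable (by fun_prop)
    · rw [Real.norm_eq_abs, abs_of_nonneg (mul_nonneg (hnn _ _) (hCpos x).le), mul_left_comm]
      exact mul_le_mul_of_nonneg_left (hCm x) (hnn _ _)
  have hTpos : 0 < Tf α f lam := by
    refine (integral_pos_iff_support_of_nonneg
      (fun x => mul_nonneg (hnn _ _) (hCpos x).le) hTint).2 ?_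
    rw [pos_iff_ne_zero]
    refine fun h => hf0 (measure_mono_null (fun x hx => ?_) h)
    have hx : f x ≠ 0 := hx
    exact mul_ne_zero (Real.rpow_pos_of_pos
      (abs_pos.2 (mul_ne_zero (inv_ne_zero hlam0.ne') hx)) _).ne' (hCpos x).ne'
  set ξ₁ := q ^ (j0 lam q + 1) with hξ₁
  set ξ₂ := q ^ (j0 lam q - 1) with hξ₂
  have hξ₁0 : 0 < ξ₁ := zpow_pos hq0 _
  have hξ₂0 : 0 < ξ₂ := zpow_pos hq0 _
  have h12 : ξ₁ = q ^ 2 * ξ₂ := by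
    rw [hξ₁, hξ₂, ← zpow_natCast, ← zpow_add₀ hq0.ne']; congr 1; push_cast; ring
  have hξ₁lam : ξ₁ ≤ q * lam := by
    rw [hξ₁, zpow_add_one₀ hq0.ne', mul_comm]
    exact mul_le_mul_of_nonneg_left (zpow_j0_le hq1 hlam0) hq0.le
  have hlamξ₂ : lam ≤ q ^ 2 * ξ₂ := h12 ▸ (lt_zpow_j0_add_one hq1 hlam0).le
  refine ⟨?_, ?_, ?_⟩
  · rw [le_div_iff₀ hTpos, Real.rpow_neg hq0.le, inv_mul_le_iff₀ (Real.rpow_pos_of_pos hq0 _),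
      (htau ξ₁).2, ← integral_const_mul]
    refine integral_mono hTint ((htau ξ₁).1.const_mul _) fun x => ?_
    calc |lam⁻¹ * f x| ^ α x * Cfun (α x)
        ≤ (q ^ b * |ξ₁⁻¹ * f x| ^ α x) * (q ^ b * m x) :=
          mul_le_mul (abs_inv_mul_rpow_le hlam0 hξ₁0 hq1.le hξ₁lam (hα0 x).le (hα x).2 _) (hCm x)
            (hCpos x).le (mul_nonneg (Real.rpow_nonneg hq0.le _) (hnn _ _))
      _ = q ^ (2 * b) * (|ξ₁⁻¹ * f x| ^ α x * m x) := by
          rw [two_mul, Real.rpow_add hq0]; ring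
  · refine div_le_div_of_nonneg_right ?_ hTpos.le
    rw [(htau ξ₁).2, (htau ξ₂).2]
    refine integral_mono (htau ξ₁).1 (htau ξ₂).1 fun x => ?_
    refine mul_le_mul_of_nonneg_right ?_ (hmpos x)
    have h21 : ξ₂ ≤ 1 * ξ₁ := by rw [h12, one_mul]; nlinarith
    simpa using abs_inv_mul_rpow_le hξ₁0 hξ₂0 le_rfl h21 (hα0 x).le (hα x).2 (f x)
  · rw [div_le_iff₀ hTpos, (htau ξ₂).2, Tf, ← integral_const_mul]
    refine integral_mono (htau ξ₂).1 (hTint.const_mul _) fun x => ?_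
    have h23 : (q ^ 2) ^ b ≤ q ^ (3 * b) := by
      rw [← Real.rpow_natCast_mul hq0.le]
      exact Real.rpow_le_rpow_of_exponent_le hq1.le (by push_cast; linarith)
    calc |ξ₂⁻¹ * f x| ^ α x * m x
        ≤ ((q ^ 2) ^ b * |lam⁻¹ * f x| ^ α x) * Cfun (α x) :=
          mul_le_mul (abs_inv_mul_rpow_le hξ₂0 hlam0 (one_le_pow₀ hq1.le) hlamξ₂ (hα0 x).le
            (hα x).2 _) (hmbd x).2 (hmpos x)
            (mul_nonneg (Real.rpow_nonneg (by positivity) _) (hnn _ _))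
      _ ≤ q ^ (3 * b) * (|lam⁻¹ * f x| ^ α x * Cfun (α x)) := by
          rw [mul_assoc]
          exact mul_le_mul_of_nonneg_right h23 (mul_nonneg (hnn _ _) (hCpos x).le)
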